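/- arXiv:1502.06018 — 3 statements merged into one kernel-verified Lean document; each statement's English description precedes it below -/
import Mathlib

section
/- Let (M, H, h) be a sub-Riemannian manifold, g a Riemannian metric on M taming h, V the g-orthogonal complement of H, and ∇̂ the associated connection. Let {·,·} denote the Poisson bracket with respect to the canonical symplectic form on T*M. Then {H^h, H^v} = {H^h, H^g} = 0 if and only if ∇̂g = 0. -/
/-!
We work with manifolds modelled as (finite-dimensional real) normed vector spaces,
so that the tangent space at every point of `E` is `E` itself, the cotangent space is
`Dual E = E →L[ℝ] ℝ`, the cotangent bundle is `E × Dual E`, vector fields are maps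
`E → E`, one-forms are maps `E → Dual E`, and affine connections are encoded by their
Christoffel tensors `Γ : E → E →L[ℝ] E →L[ℝ] E` via `∇_X Y = (DY)(X) + Γ(X, Y)`.
-/

noncomputable section

namespace SubRiemannian

variable {E : Type*} [NormedAddCommGroup E] [NormedSpace ℝ E]

/-- The fiber of the cotangent bundle of the (trivialized) manifold `E`. -/
abbrev Dual (E : Type*) [NormedAddCommGroup E] [NormedSpace ℝ E] : Type _ := E →L[ℝ] ℝ

/-- Lie bracket of vector fields on `E`. -/
def lieB (X Y : E → E) : E → E := fun x => fderiv ℝ Y x (X x) - fderiv ℝ X x (Y x)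

/-- Covariant derivative `∇_X Y` of the affine connection with Christoffel tensor `Γ`. -/
def cov (Γ : E → E →L[ℝ] E →L[ℝ] E) (X Y : E → E) : E → E :=
  fun x => fderiv ℝ Y x (X x) + Γ x (X x) (Y x)

/-- Torsion tensor of the affine connection with Christoffel tensor `Γ`. -/
def torsion (Γ : E → E →L[ℝ] E →L[ℝ] E) (x u v : E) : E := Γ x u v - Γ x v u

/-- `Γ` is the Christoffel tensor of the Levi-Civita connection of the metric `g`:
it is torsion-free and metric-compatible. -/
def IsLeviCivita (g : E → E → E → ℝ) (Γ : E → E →L[ℝ] E →L[ℝ] E) : Prop :=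
  (∀ x u v, Γ x u v = Γ x v u) ∧
  (∀ x u v w, fderiv ℝ (fun y => g y v w) x u = g x (Γ x u v) w + g x v (Γ x u w))

/-- `g` is a Riemannian metric on `E` (a smooth field of symmetric positive definite
bilinear forms). -/
structure IsMetric (g : E → E → E → ℝ) : Prop where
  smooth : ContDiff ℝ (⊤ : ℕ∞) (fun q : E × E × E => g q.1 q.2.1 q.2.2)
  linL : ∀ x v, IsLinearMap ℝ (fun u => g x u v)
  linR : ∀ x u, IsLinearMap ℝ (fun v => g x u v)
  symm : ∀ x u v, g x u v = g x v u
  posdef : ∀ x v, v ≠ 0 → 0 < g x v v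

/-- `sharp` realizes the identification `♯` of `T*M` with `TM` via the metric `g`. -/
structure IsSharp (g : E → E → E → ℝ) (sharp : E → Dual E → E) : Prop where
  lin : ∀ x, IsLinearMap ℝ (sharp x)
  smooth : ContDiff ℝ (⊤ : ℕ∞) (fun q : E × Dual E => sharp q.1 q.2)
  spec : ∀ x p v, g x (sharp x p) v = p v

/-- `prH` and `prV` are the `g`-orthogonal projections onto a (smooth) subbundle `H` of the
tangent bundle (the range of `prH`) and its `g`-orthogonal complement `V` (the range of
`prV`). -/
structure IsOrthProjs (g : E → E → E → ℝ) (prH prV : E → E →L[ℝ] E) : Prop where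
  smooth : ContDiff ℝ (⊤ : ℕ∞) prH
  compl : ∀ x v, prH x v + prV x v = v
  idem : ∀ x v, prH x (prH x v) = prH x v
  orth : ∀ x u v, g x (prH x u) (prV x v) = 0

/-- The connection `∇̂` associated to a metric `g` (with Levi-Civita Christoffel tensor `Γ`)
and an orthogonal splitting `TM = H ⊕ V`:
`∇̂_X Y = pr_H ∇^g_{pr_H X} pr_H Y + pr_V ∇^g_{pr_V X} pr_V Y
          + pr_H [pr_V X, pr_H Y] + pr_V [pr_H X, pr_V Y]`. -/
def hatN (Γ : E → E →L[ℝ] E →L[ℝ] E) (prH prV : E → E →L[ℝ] E) (X Y : E → E) : E → E :=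
  fun x =>
    prH x (cov Γ (fun y => prH y (X y)) (fun y => prH y (Y y)) x)
    + prV x (cov Γ (fun y => prV y (X y)) (fun y => prV y (Y y)) x)
    + prH x (lieB (fun y => prV y (X y)) (fun y => prH y (Y y)) x)
    + prV x (lieB (fun y => prH y (X y)) (fun y => prV y (Y y)) x)

/-- The covariant derivative `(∇_X g)(Y, Z)` of the metric `g` with respect to a connection
`D` on vector fields. -/
def covMet (D : (E → E) → (E → E) → E → E) (g : E → E → E → ℝ) (X Y Z : E → E) : E → ℝ :=
  fun x => fderiv ℝ (fun y => g y (Y y) (Z y)) x (X x)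
    - g x (D X Y x) (Z x) - g x (Y x) (D X Z x)

/-- Pointwise covariant derivative `(∇_u g)(v, w)` at `x`, computed with the constant
extensions of the tangent vectors `u`, `v`, `w`. -/
def covMetPt (D : (E → E) → (E → E) → E → E) (g : E → E → E → ℝ) (x u v w : E) : ℝ :=
  covMet D g (fun _ => u) (fun _ => v) (fun _ => w) x

/-- The Lie derivative `(L_X g)(Y, Z)` of the metric `g`. -/
def lieMet (g : E → E → E → ℝ) (X Y Z : E → E) : E → ℝ :=
  fun x => fderiv ℝ (fun y => g y (Y y) (Z y)) x (X x)
    - g x (lieB X Y x) (Z x) - g x (Y x) (lieB X Z x)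

/-- `sstar` is a (possibly degenerate) positive semidefinite symmetric cometric on the
cotangent bundle, with associated musical map `ssharp` (`s*(α, p) = α(♯_s p)`). -/
structure IsCometric (sstar : E → Dual E → Dual E → ℝ) (ssharp : E → Dual E → E) : Prop where
  lin : ∀ x, IsLinearMap ℝ (ssharp x)
  smooth : ContDiff ℝ (⊤ : ℕ∞) (fun q : E × Dual E => ssharp q.1 q.2)
  symm : ∀ x α β, sstar x α β = sstar x β α
  psd : ∀ x p, 0 ≤ sstar x p p
  spec : ∀ x α p, sstar x α p = α (ssharp x p)

/-- The Hamiltonian `H(p) = ½ s*(p, p)` of a cometric. -/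
def ham (sstar : E → Dual E → Dual E → ℝ) : E × Dual E → ℝ :=
  fun z => (1 / 2) * sstar z.1 z.2 z.2

/-- The Liouville one-form `ϑ` on the cotangent bundle `T*M = E × Dual E`:
`ϑ|_p(v) = p(Π^M_* v)`. -/
def liouville : E × Dual E → (E × Dual E) →L[ℝ] ℝ :=
  fun z => z.2.comp (ContinuousLinearMap.fst ℝ E (Dual E))

/-- The exterior derivative of a one-form on a vector space, evaluated at a point on a pair
of (constant extensions of) tangent vectors:
`dω(U,V) = U ω(V) - V ω(U) - ω([U,V])` with `[U,V] = 0` for constant fields. -/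
def extd {N : Type*} [NormedAddCommGroup N] [NormedSpace ℝ N]
    (ω : N → N →L[ℝ] ℝ) (z u v : N) : ℝ :=
  fderiv ℝ (fun w => ω w v) z u - fderiv ℝ (fun w => ω w u) z v

/-- The canonical symplectic form `ς = -dϑ` on `T*M = E × Dual E`. -/
def symp (z u v : E × Dual E) : ℝ := -(extd liouville z u v)

/-- `X` is the Hamiltonian vector field of `H` with respect to the canonical symplectic
form: `dH = ς(X, ·)`. -/
def IsHamVF (H : E × Dual E → ℝ) (X : E × Dual E → E × Dual E) : Prop :=
  ∀ z w, fderiv ℝ H z w = symp z (X z) w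

/-- `Φ` is the (global) flow of the vector field `X`. -/
def IsFlow {N : Type*} [NormedAddCommGroup N] [NormedSpace ℝ N]
    (X : N → N) (Φ : ℝ → N → N) : Prop :=
  (∀ z, Φ 0 z = z) ∧ ∀ z t, HasDerivAt (fun s => Φ s z) (X (Φ t z)) t

/-- `Exp x v t` is the value at time `t` of the geodesic of the connection `Γ` starting at
`x` with initial velocity `v`, with velocity field `DExp x v t`; so `Exp x v 1` is the
(Riemannian) exponential `exp(x, v)` and `Exp x v t = exp(x, t v)`. -/
def IsExpMap (Γ : E → E →L[ℝ] E →L[ℝ] E) (Exp DExp : E → E → ℝ → E) : Prop :=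
  ∀ x v, Exp x v 0 = x ∧ DExp x v 0 = v ∧
    ∀ t, HasDerivAt (Exp x v) (DExp x v t) t ∧
      HasDerivAt (DExp x v) (-(Γ (Exp x v t) (DExp x v t) (DExp x v t))) t

/-- `P t` is parallel transport (with respect to the connection `Γ`) along the curve `γ`
with velocity `dγ`, from time `0` to time `t`. -/
def IsParTrans (Γ : E → E →L[ℝ] E →L[ℝ] E) (γ dγ : ℝ → E) (P : ℝ → E → E) : Prop :=
  (∀ w, P 0 w = w) ∧ ∀ w t, HasDerivAt (fun s => P s w) (-(Γ (γ t) (dγ t) (P t w))) t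

/-- Pointwise Christoffel tensor of the connection `∇̂` (computed on constant extensions). -/
def hatGamma (Γ : E → E →L[ℝ] E →L[ℝ] E) (prH prV : E → E →L[ℝ] E) (x u v : E) : E :=
  hatN Γ prH prV (fun _ => u) (fun _ => v) x

/-- The curvature `R(u, w) = pr_V [pr_H U, pr_H W]` of the subbundle `H`
(pointwise, via constant extensions). -/
def curvPt (prH prV : E → E →L[ℝ] E) (x u w : E) : E :=
  prV x (lieB (fun y => prH y u) (fun y => prH y w) x)

/-- The cocurvature `R̄(u, w) = pr_H [pr_V U, pr_V W]` of the subbundle `H`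
(pointwise, via constant extensions). -/
def cocurvPt (prH prV : E → E →L[ℝ] E) (x u w : E) : E :=
  prH x (lieB (fun y => prV y u) (fun y => prV y w) x)

/-- The curvature of `H` evaluated on vector fields. -/
def curv (prH prV : E → E →L[ℝ] E) (X Y : E → E) : E → E :=
  fun x => prV x (lieB (fun y => prH y (X y)) (fun y => prH y (Y y)) x)

/-- The cocurvature of `H` evaluated on vector fields. -/
def cocurv (prH prV : E → E →L[ℝ] E) (X Y : E → E) : E → E :=
  fun x => prH x (lieB (fun y => prV y (X y)) (fun y => prV y (Y y)) x)

/-- The covariant derivative `(∇_w s*)(p, p)` of a cometric with respect to the connection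
with Christoffel tensor `Γ`. -/
def covCo (Γ : E → E →L[ℝ] E →L[ℝ] E) (sstar : E → Dual E → Dual E → ℝ)
    (ssharp : E → Dual E → E) (x w : E) (p : Dual E) : ℝ :=
  fderiv ℝ (fun y => sstar y p p) x w + 2 * p (Γ x w (ssharp x p))

/-- The covariant derivative `(∇̂_w s*)(p, p)` of a cometric with respect to `∇̂`. -/
def covCoHat (Γ : E → E →L[ℝ] E →L[ℝ] E) (prH prV : E → E →L[ℝ] E)
    (sstar : E → Dual E → Dual E → ℝ) (ssharp : E → Dual E → E)
    (x w : E) (p : Dual E) : ℝ :=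
  fderiv ℝ (fun y => sstar y p p) x w + 2 * p (hatGamma Γ prH prV x w (ssharp x p))

/-- The horizontal lift of a vector field on `M` to `T*M`, with respect to the Ehresmann
connection `E^∇` on `T*M` induced by the affine connection with Christoffel tensor `Γ`
(whose tangent curves are the `∇`-parallel covector fields along their projections). -/
def hlift (Γ : E → E →L[ℝ] E →L[ℝ] E) (X : E → E) (z : E × Dual E) : E × Dual E :=
  (X z.1, z.2.comp (Γ z.1 (X z.1)))

/-- The horizontal lift `h_p u` of a single tangent vector `u` to `p ∈ T*M`. -/
def hliftPt (Γ : E → E →L[ℝ] E →L[ℝ] E) (z : E × Dual E) (u : E) : E × Dual E :=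
  (u, z.2.comp (Γ z.1 u))

/-- The vertical lift of a one-form on `M` to `T*M`. -/
def vlift (α : E → Dual E) (z : E × Dual E) : E × Dual E := (0, α z.1)

/-- The vertical lift `vl_p q` of a single covector `q` at `p ∈ T*M`. -/
def vliftPt (_z : E × Dual E) (q : Dual E) : E × Dual E := (0, q)

/-- The musical map `♯_h = pr_H ∘ ♯` of the sub-Riemannian metric `h = g|_H` obtained by
restricting a Riemannian metric `g` (with sharp map `sharp`) to the subbundle `H`. -/
def subSharp (prH : E → E →L[ℝ] E) (sharp : E → Dual E → E) : E → Dual E → E :=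
  fun x p => prH x (sharp x p)

/-- The cometric `h*` of the sub-Riemannian metric `h = g|_H`:
`h*(α, β) = β(pr_H ♯α)`. -/
def subStar (prH : E → E →L[ℝ] E) (sharp : E → Dual E → E) : E → Dual E → Dual E → ℝ :=
  fun x α β => β (prH x (sharp x α))

end SubRiemannian

namespace SubRiemannian

variable {E : Type*} [NormedAddCommGroup E] [NormedSpace ℝ E]

lemma symp_eq (z u v : E × Dual E) : symp z u v = v.2 u.1 - u.2 v.1 := by
  have key : ∀ a b : E × Dual E, fderiv ℝ (fun w : E × Dual E => liouville w a) z b = b.2 a.1 := by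
    intro a b
    have h : HasFDerivAt (fun w : E × Dual E => liouville w a)
        ((ContinuousLinearMap.apply ℝ ℝ a.1).comp (ContinuousLinearMap.snd ℝ E (Dual E))) z := by
      exact ((ContinuousLinearMap.apply ℝ ℝ a.1).comp
        (ContinuousLinearMap.snd ℝ E (Dual E))).hasFDerivAt
    rw [h.fderiv]
    simp
  unfold symp extd
  rw [key, key]
  ring

section
variable [FiniteDimensional ℝ E]

/-- Derivative of `g_y(a(y), b(y))` through the Levi-Civita Christoffel tensor. -/
lemma hasFDerivAt_metric {g : E → E → E → ℝ} (hg : IsMetric g)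
    {Γ : E → E →L[ℝ] E →L[ℝ] E} (hLC : IsLeviCivita g Γ)
    {a b : E → E} {a' b' : E →L[ℝ] E} {x : E} (ha : HasFDerivAt a a' x)
    (hb : HasFDerivAt b b' x) (u : E) :
    fderiv ℝ (fun y => g y (a y) (b y)) x u
      = g x (Γ x u (a x)) (b x) + g x (a x) (Γ x u (b x)) + g x (a' u) (b x)
        + g x (a x) (b' u) := by
  have hd : DifferentiableAt ℝ (fun q : E × E × E => g q.1 q.2.1 q.2.2) (x, a x, b x) :=
    (hg.smooth.differentiable (by simp)).differentiableAt
  obtain ⟨L, hL⟩ := hd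
  have h0 : HasFDerivAt (fun y => g y (a y) (b y))
      (L.comp ((ContinuousLinearMap.id ℝ E).prod (a'.prod b'))) x :=
    HasFDerivAt.comp x (f := fun y : E => (y, a y, b y)) hL
      ((hasFDerivAt_id x).prodMk (ha.prodMk hb))
  have h1 : HasFDerivAt (fun y => g y (a x) (b x))
      (L.comp ((ContinuousLinearMap.id ℝ E).prod ((0 : E →L[ℝ] E).prod (0 : E →L[ℝ] E)))) x :=
    HasFDerivAt.comp x (f := fun y : E => (y, a x, b x)) hL
      ((hasFDerivAt_id x).prodMk ((hasFDerivAt_const _ x).prodMk (hasFDerivAt_const _ x)))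
  have h2 : HasFDerivAt (fun c => g x c (b x))
      (L.comp ((0 : E →L[ℝ] E).prod ((ContinuousLinearMap.id ℝ E).prod (0 : E →L[ℝ] E)))) (a x) :=
    HasFDerivAt.comp (a x) (f := fun c : E => (x, c, b x)) hL
      ((hasFDerivAt_const _ _).prodMk ((hasFDerivAt_id _).prodMk (hasFDerivAt_const _ _)))
  have h3 : HasFDerivAt (fun c => g x (a x) c)
      (L.comp ((0 : E →L[ℝ] E).prod ((0 : E →L[ℝ] E).prod (ContinuousLinearMap.id ℝ E)))) (b x) :=
    HasFDerivAt.comp (b x) (f := fun c : E => (x, a x, c)) hL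
      ((hasFDerivAt_const _ _).prodMk ((hasFDerivAt_const _ _).prodMk (hasFDerivAt_id _)))
  have h2' : HasFDerivAt (fun c => g x c (b x))
      (LinearMap.toContinuousLinearMap (IsLinearMap.mk' _ (hg.linL x (b x)))) (a x) :=
    (LinearMap.toContinuousLinearMap (IsLinearMap.mk' _ (hg.linL x (b x)))).hasFDerivAt
  have h3' : HasFDerivAt (fun c => g x (a x) c)
      (LinearMap.toContinuousLinearMap (IsLinearMap.mk' _ (hg.linR x (a x)))) (b x) :=
    (LinearMap.toContinuousLinearMap (IsLinearMap.mk' _ (hg.linR x (a x)))).hasFDerivAt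
  have e1 := hLC.2 x u (a x) (b x)
  rw [h1.fderiv] at e1
  have e2 := congrArg (fun M : E →L[ℝ] ℝ => M (a' u)) (h2.unique h2')
  have e3 := congrArg (fun M : E →L[ℝ] ℝ => M (b' u)) (h3.unique h3')
  have e1' : L (u, 0, 0) = g x (Γ x u (a x)) (b x) + g x (a x) (Γ x u (b x)) := e1
  have e2' : L (0, a' u, 0) = g x (a' u) (b x) := e2
  have e3' : L (0, 0, b' u) = g x (a x) (b' u) := e3
  rw [h0.fderiv]
  have : L (u, a' u, b' u) = L (u, 0, 0) + L (0, a' u, 0) + L (0, 0, b' u) := by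
    rw [← map_add, ← map_add]; simp
  calc _ = L (u, a' u, b' u) := rfl
    _ = _ := by rw [this, e1', e2', e3']

/-- Differential of the Hamiltonian `½ p(R ♯ p)` for a `g`-symmetric `R`. -/
lemma fderiv_ham {g : E → E → E → ℝ} (hg : IsMetric g)
    {Γ : E → E →L[ℝ] E →L[ℝ] E} (hLC : IsLeviCivita g Γ)
    {sharp : E → Dual E → E} (hs : IsSharp g sharp)
    {R : E → E →L[ℝ] E} (hR : ContDiff ℝ (⊤ : ℕ∞) R)
    (hRs : ∀ x u v, g x (R x u) v = g x u (R x v)) (x u : E) (p q : Dual E) :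
    fderiv ℝ (fun z : E × Dual E => (1 / 2) * z.2 (R z.1 (sharp z.1 z.2))) (x, p) (u, q)
      = 1 / 2 * (g x (sharp x p) (fderiv ℝ R x u (sharp x p))
          - g x (Γ x u (sharp x p)) (R x (sharp x p))
          - g x (sharp x p) (Γ x u (R x (sharp x p)))) + q (R x (sharp x p)) := by
  have hRd : HasFDerivAt R (fderiv ℝ R x) x :=
    (hR.differentiable (by simp)).differentiableAt.hasFDerivAt
  have hSd : DifferentiableAt ℝ (fun q : E × Dual E => sharp q.1 q.2) (x, p) :=
    (hs.smooth.differentiable (by simp)).differentiableAt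
  obtain ⟨S', hS'⟩ := hSd
  have hsx : HasFDerivAt (fun y => sharp y p)
      (S'.comp ((ContinuousLinearMap.id ℝ E).prod (0 : E →L[ℝ] Dual E))) x :=
    HasFDerivAt.comp x (f := fun y : E => (y, p)) hS'
      ((hasFDerivAt_id x).prodMk (hasFDerivAt_const _ x))
  have hsp : HasFDerivAt (fun r => sharp x r)
      (S'.comp ((0 : Dual E →L[ℝ] E).prod (ContinuousLinearMap.id ℝ (Dual E)))) p :=
    HasFDerivAt.comp p (f := fun r : Dual E => (x, r)) hS'
      ((hasFDerivAt_const _ _).prodMk (hasFDerivAt_id _))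
  have hsp' : HasFDerivAt (fun r => sharp x r)
      (LinearMap.toContinuousLinearMap (IsLinearMap.mk' _ (hs.lin x))) p :=
    (LinearMap.toContinuousLinearMap (IsLinearMap.mk' _ (hs.lin x))).hasFDerivAt
  have e2 : S' (0, q) = sharp x q :=
    congrArg (fun M : Dual E →L[ℝ] E => M q) (hsp.unique hsp')
  have e1 : ∀ w, g x (S' (u, 0)) w
      = -(g x (Γ x u (sharp x p)) w + g x (sharp x p) (Γ x u w)) := by
    intro w
    have h := hasFDerivAt_metric hg hLC hsx (hasFDerivAt_const w x) u
    have hc : (fun y => g y (sharp y p) w) = fun _ => p w := by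
      funext y; exact hs.spec y p w
    rw [hc] at h
    have h0 : g x (sharp x p) 0 = 0 := (hg.linR x _).map_zero
    simp [h0] at h
    linarith
  have hz1 : HasFDerivAt (fun z : E × Dual E => R z.1)
      ((fderiv ℝ R x).comp (ContinuousLinearMap.fst ℝ E (Dual E))) (x, p) :=
    HasFDerivAt.comp (x, p) (f := fun z : E × Dual E => z.1) hRd hasFDerivAt_fst
  have hz2 := hz1.clm_apply hS'
  have hz3 : HasFDerivAt (fun z : E × Dual E => z.2)
      (ContinuousLinearMap.snd ℝ E (Dual E)) (x, p) := hasFDerivAt_snd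
  have hz4 := (hz3.clm_apply hz2).const_mul (1 / 2)
  rw [hz4.fderiv]
  have hS : S' (u, q) = S' (u, 0) + sharp x q := by
    rw [← e2, ← map_add]; simp
  have f1 : ∀ v, p v = g x (sharp x p) v := fun v => (hs.spec x p v).symm
  have f2 : p (R x (S' (u, 0))) = -(g x (Γ x u (sharp x p)) (R x (sharp x p))
      + g x (sharp x p) (Γ x u (R x (sharp x p)))) := by
    rw [← e1, f1, ← hRs, hg.symm]
  have f3 : p (R x (sharp x q)) = q (R x (sharp x p)) := by
    rw [f1, ← hRs, hg.symm, hs.spec]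
  have f4 := f1 (fderiv ℝ R x u (sharp x p))
  simp [hS, f2, f3, f4]
  ring

lemma sharp_surj {g : E → E → E → ℝ} (hg : IsMetric g)
    {sharp : E → Dual E → E} (hs : IsSharp g sharp) (x v : E) : ∃ p, sharp x p = v := by
  refine ⟨LinearMap.toContinuousLinearMap (IsLinearMap.mk' _ (hg.linR x v)), ?_⟩
  set p : Dual E := LinearMap.toContinuousLinearMap (IsLinearMap.mk' _ (hg.linR x v)) with hp
  by_contra hne
  have h1 := hg.posdef x _ (sub_ne_zero.2 hne)
  have h2 := (hg.linL x (sharp x p - v)).map_sub (sharp x p) v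
  have h3 := hs.spec x p (sharp x p - v)
  have h4 : p (sharp x p - v) = g x v (sharp x p - v) := rfl
  linarith

end

/-- The algebraic core: `T` stands for `g((∇_u P) v, w)`. -/
lemma cubic_iff (T : E → E → E → ℝ) (P Q : E → E)
    (hPQ : ∀ v, P v + Q v = v) (hPa : ∀ u v, P (u + v) = P u + P v)
    (hQa : ∀ u v, Q (u + v) = Q u + Q v) (hPn : ∀ u, P (-u) = - P u) (hQn : ∀ u, Q (-u) = - Q u)
    (hPP : ∀ v, P (P v) = P v) (hQQ : ∀ v, Q (Q v) = Q v)
    (hPQ0 : ∀ v, P (Q v) = 0) (hQP0 : ∀ v, Q (P v) = 0)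
    (a1 : ∀ u u' v w, T (u + u') v w = T u v w + T u' v w)
    (a2 : ∀ u v v' w, T u (v + v') w = T u v w + T u v' w)
    (a3 : ∀ u v w w', T u v (w + w') = T u v w + T u v w')
    (n1 : ∀ u v w, T (-u) v w = - T u v w)
    (n2 : ∀ u v w, T u (-v) w = - T u v w)
    (n3 : ∀ u v w, T u v (-w) = - T u v w)
    (sy : ∀ u v w, T u v w = T u w v)
    (pp : ∀ u v w, T u (P v) (P w) = 0) (qq : ∀ u v w, T u (Q v) (Q w) = 0) :
    (∀ s, T s s s = 0) ↔
    ∀ u v w, T (P v) u (P w) + T (P w) u (P v) - T (Q v) u (Q w) - T (Q w) u (Q v) = 0 := by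
  have exp : ∀ s, T s s s = 2 * T (P s) (Q s) (P s) + 2 * T (Q s) (P s) (Q s) := by
    intro s
    have h : T s s s = T (P s + Q s) (P s + Q s) (P s + Q s) := by rw [hPQ]
    rw [h]
    simp only [a1, a2, a3, pp, qq]
    rw [sy (P s) (P s) (Q s), sy (Q s) (Q s) (P s)]
    ring
  have red : ∀ u v w, T (P v) u (P w) + T (P w) u (P v) - T (Q v) u (Q w) - T (Q w) u (Q v)
      = T (P v) (Q u) (P w) + T (P w) (Q u) (P v) - T (Q v) (P u) (Q w) - T (Q w) (P u) (Q v) := by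
    intro u v w
    have h : ∀ a w, T a u (P w) = T a (Q u) (P w) := by
      intro a w
      conv_lhs => rw [← hPQ u]
      rw [a2, pp, zero_add]
    have h' : ∀ a w, T a u (Q w) = T a (P u) (Q w) := by
      intro a w
      conv_lhs => rw [← hPQ u]
      rw [a2, qq, add_zero]
    simp only [h, h']
  constructor
  · intro hs u v w
    have k : ∀ a b, T (P a) (Q b) (P a) = 0 ∧ T (Q b) (P a) (Q b) = 0 := by
      intro a b
      have h1 := hs (P a + Q b)
      have h2 := hs (P a + -(Q b))
      rw [exp] at h1 h2
      simp only [hPa, hQa, hPn, hQn, hPP, hQQ, hPQ0, hQP0, add_zero, zero_add, neg_zero, n1, n2, n3]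
        at h1 h2
      constructor <;> linarith
    rw [red]
    have r1 := (k (v + w) u).1
    have r2 := (k v u).1
    have r3 := (k w u).1
    have r4 := (k u (v + w)).2
    have r5 := (k u v).2
    have r6 := (k u w).2
    simp only [hPa, hQa, a1, a3] at r1 r4
    linarith
  · intro h s
    rw [exp]
    have h1 := h (Q s) (P s) (P s)
    have h2 := h (P s) (Q s) (Q s)
    simp only [hPP, hQQ, hPQ0, hQP0] at h1 h2
    have z1 : ∀ v w, T 0 v w = 0 := by
      intro v w; have := a1 0 0 v w; simp at this; exact this
    simp only [z1] at h1 h2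
    linarith

end SubRiemannian

open SubRiemannian in
/-- **Lemma (commuting Hamiltonians).**
Let `(M, H, h)` be a sub-Riemannian manifold, `g` a Riemannian metric taming `h`
(so `h = g|_H`, with cometric `h*` and Hamiltonian `H^h`), `V` the `g`-orthogonal
complement of `H`, and `∇̂` the associated connection.  Then
`{H^h, H^v} = {H^h, H^g} = 0` (Poisson brackets with respect to the canonical symplectic
form on `T*M`, i.e. `ς(H⃗^h, H⃗^v) = ς(H⃗^h, H⃗^g) = 0`) if and only if `∇̂ g = 0`. -/
theorem statement1
    {E : Type*} [NormedAddCommGroup E] [NormedSpace ℝ E] [FiniteDimensional ℝ E]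
    (g : E → E → E → ℝ) (hg : IsMetric g)
    (gsharp : E → Dual E → E) (hgs : IsSharp g gsharp)
    (prH prV : E → E →L[ℝ] E) (hpr : IsOrthProjs g prH prV)
    (Γg : E → E →L[ℝ] E →L[ℝ] E) (hΓs : ContDiff ℝ (⊤ : ℕ∞) Γg) (hLC : IsLeviCivita g Γg)
    (Xh Xv Xg : E × Dual E → E × Dual E)
    (hXh : IsHamVF (ham (subStar prH gsharp)) Xh)
    (hXv : IsHamVF (ham (subStar prV gsharp)) Xv)
    (hXg : IsHamVF (fun z => (1 / 2) * z.2 (gsharp z.1 z.2)) Xg) :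
    ((∀ z, symp z (Xh z) (Xv z) = 0) ∧ (∀ z, symp z (Xh z) (Xg z) = 0)) ↔
      (∀ x u v w, covMetPt (hatN Γg prH prV) g x u v w = 0) := by
  have hP : ContDiff ℝ (⊤ : ℕ∞) prH := hpr.smooth
  have hQv : ∀ x v, prV x v = v - prH x v := fun x v => by
    rw [eq_sub_iff_add_eq, add_comm]; exact hpr.compl x v
  have hQeq : prV = fun x => ContinuousLinearMap.id ℝ E - prH x := by
    funext x; ext v; simp [hQv]
  have hQ : ContDiff ℝ (⊤ : ℕ∞) prV := by
    rw [hQeq]; exact contDiff_const.sub hP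
  have ga1 : ∀ x u u' v, g x (u + u') v = g x u v + g x u' v := fun x u u' v =>
    (hg.linL x v).map_add u u'
  have ga2 : ∀ x u v v', g x u (v + v') = g x u v + g x u v' := fun x u v v' =>
    (hg.linR x u).map_add v v'
  have gn1 : ∀ x u v, g x (-u) v = - g x u v := fun x u v => (hg.linL x v).map_neg u
  have gn2 : ∀ x u v, g x u (-v) = - g x u v := fun x u v => (hg.linR x u).map_neg v
  have gs1 : ∀ x u u' v, g x (u - u') v = g x u v - g x u' v := fun x u u' v =>
    (hg.linL x v).map_sub u u'
  have gs2 : ∀ x u v v', g x u (v - v') = g x u v - g x u v' := fun x u v v' =>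
    (hg.linR x u).map_sub v v'
  have g0 : ∀ x u, g x u 0 = 0 := fun x u => (hg.linR x u).map_zero
  have Psym : ∀ x u v, g x (prH x u) v = g x u (prH x v) := by
    intro x u v
    have h1 := hpr.orth x u v
    have h2 := hpr.orth x v u
    rw [hQv, gs2] at h1 h2
    rw [hg.symm x u]
    rw [hg.symm x (prH x v) (prH x u)] at h2
    linarith
  have Qsym : ∀ x u v, g x (prV x u) v = g x u (prV x v) := by
    intro x u v
    rw [hQv, hQv, gs1, gs2, Psym]
  have hPd : ∀ x, HasFDerivAt prH (fderiv ℝ prH x) x := fun x =>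
    (hP.differentiable (by simp)).differentiableAt.hasFDerivAt
  have hQd : ∀ x, HasFDerivAt prV (-fderiv ℝ prH x) x := fun x => by
    have h := (hasFDerivAt_const (ContinuousLinearMap.id ℝ E) x).sub (hPd x)
    rw [zero_sub] at h
    rw [hQeq]
    exact h
  have hPc : ∀ x v, HasFDerivAt (fun y => prH y v) ((fderiv ℝ prH x).flip v) x := fun x v => by
    have h := (hPd x).clm_apply (hasFDerivAt_const v x)
    simpa using h
  have hQc : ∀ x v, HasFDerivAt (fun y => prV y v) (-(fderiv ℝ prH x).flip v) x := fun x v => by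
    have h := (hQd x).clm_apply (hasFDerivAt_const v x)
    convert h using 1
    ext w; simp
  -- derivative of idempotency
  have Aid : ∀ x u v, fderiv ℝ prH x u (prH x v) + prH x (fderiv ℝ prH x u v)
      = fderiv ℝ prH x u v := by
    intro x u v
    have h := (hPd x).clm_apply (hPc x v)
    have he : (fun y => prH y (prH y v)) = fun y => prH y v := by
      funext y; exact hpr.idem y v
    rw [he] at h
    have := congrArg (fun M : E →L[ℝ] E => M u) (h.unique (hPc x v))
    simp at this
    rw [add_comm]; exact this
  have APz : ∀ x u v, prH x (fderiv ℝ prH x u (prH x v)) = 0 := by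
    intro x u v
    have h := congrArg (prH x) (Aid x u v)
    rw [map_add, hpr.idem] at h
    simpa using h
  -- derivative of symmetry
  have Asym : ∀ x u v w, g x (Γg x u (prH x v)) w + g x (prH x v) (Γg x u w)
      + g x (fderiv ℝ prH x u v) w
      = g x (Γg x u v) (prH x w) + g x v (Γg x u (prH x w)) + g x v (fderiv ℝ prH x u w) := by
    intro x u v w
    have h1 := hasFDerivAt_metric hg hLC (hPc x v) (hasFDerivAt_const w x) u
    have h2 := hasFDerivAt_metric hg hLC (hasFDerivAt_const v x) (hPc x w) u
    have he : (fun y => g y (prH y v) w) = fun y => g y v (prH y w) := by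
      funext y; exact Psym y v w
    rw [he, h2] at h1
    have g0' : ∀ u, g x 0 u = 0 := fun u => by rw [hg.symm, g0]
    simp [g0, g0'] at h1
    linarith
  -- the three differentials
  have dh : ∀ x u p q, fderiv ℝ (ham (subStar prH gsharp)) (x, p) (u, q) = _ :=
    fun x u p q => fderiv_ham hg hLC hgs hP Psym x u p q
  have dv : ∀ x u p q, fderiv ℝ (ham (subStar prV gsharp)) (x, p) (u, q) = _ :=
    fun x u p q => fderiv_ham hg hLC hgs hQ Qsym x u p q
  have dg : ∀ x u p q,
      fderiv ℝ (fun z : E × Dual E => (1 / 2) * z.2 (gsharp z.1 z.2)) (x, p) (u, q) = _ :=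
    fun x u p q => fderiv_ham hg hLC hgs (R := fun _ => ContinuousLinearMap.id ℝ E)
      contDiff_const (fun _ _ _ => rfl) x u p q
  have dsum : ∀ z w, fderiv ℝ (fun z : E × Dual E => (1 / 2) * z.2 (gsharp z.1 z.2)) z w
      = fderiv ℝ (ham (subStar prH gsharp)) z w + fderiv ℝ (ham (subStar prV gsharp)) z w := by
    rintro ⟨x, p⟩ ⟨u, q⟩
    rw [dh, dv, dg, (hQd x).fderiv]
    simp [hQv, gs2, g0, gn2]
    ring
  have sy : ∀ z a b : E × Dual E, symp z a b = - symp z b a := by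
    intro z a b; rw [symp_eq, symp_eq]; ring
  have brk : ∀ z, symp z (Xh z) (Xv z) = symp z (Xh z) (Xg z) := by
    intro z
    have h1 := dsum z (Xh z)
    rw [hXg, hXh, hXv, sy z (Xg z), sy z (Xv z)] at h1
    have h2 := sy z (Xh z) (Xh z)
    linarith
  set T : E → E → E → E → ℝ := fun x u v w =>
    g x (fderiv ℝ prH x u v + Γg x u (prH x v) - prH x (Γg x u v)) w with hT
  have Tval : ∀ x p, symp (x, p) (Xh (x, p)) (Xg (x, p))
      = 1 / 2 * T x (gsharp x p) (gsharp x p) (gsharp x p) := by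
    intro x p
    have c1 : (Xg (x, p)).1 = gsharp x p := by
      by_contra hne
      obtain ⟨r, hr⟩ : ∃ r : Dual E, r ((Xg (x, p)).1 - gsharp x p) ≠ 0 := by
        obtain ⟨r, -, hr⟩ := exists_dual_vector ℝ _ (norm_ne_zero_iff.2 (sub_ne_zero.2 hne))
        refine ⟨r, ?_⟩
        rw [hr]
        simpa using sub_ne_zero.2 hne
      apply hr
      have h := hXg (x, p) (0, r)
      rw [dg, symp_eq] at h
      have g0' : ∀ u, g x 0 u = 0 := fun u => by rw [hg.symm, g0]
      simp [g0, g0'] at h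
      simp [h]
    have c1h : (Xh (x, p)).1 = prH x (gsharp x p) := by
      by_contra hne
      obtain ⟨r, hr⟩ : ∃ r : Dual E, r ((Xh (x, p)).1 - prH x (gsharp x p)) ≠ 0 := by
        obtain ⟨r, -, hr⟩ := exists_dual_vector ℝ _ (norm_ne_zero_iff.2 (sub_ne_zero.2 hne))
        refine ⟨r, ?_⟩
        rw [hr]
        simpa using sub_ne_zero.2 hne
      apply hr
      have h := hXh (x, p) (0, r)
      rw [dh, symp_eq] at h
      have g0' : ∀ u, g x 0 u = 0 := fun u => by rw [hg.symm, g0]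
      simp [g0, g0'] at h
      simp [h]
    have h1 := hXh (x, p) ((Xg (x, p)).1, 0)
    rw [dh, symp_eq] at h1
    have h2 := hXg (x, p) ((Xh (x, p)).1, 0)
    rw [dg, symp_eq] at h2
    simp only [c1, c1h] at h1 h2
    rw [symp_eq, c1, c1h]
    simp only [zero_apply] at h1 h2
    simp at h2
    have s1 := hLC.1 x (gsharp x p) (prH x (gsharp x p))
    simp only [hT, ga1, gs1, Psym]
    rw [← s1, g0] at h2
    rw [hg.symm x (fderiv ℝ prH x _ _)]
    have s2 := hg.symm x (gsharp x p) (Γg x (gsharp x p) (prH x (gsharp x p)))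
    linarith
  have step1 : ((∀ z, symp z (Xh z) (Xv z) = 0) ∧ (∀ z, symp z (Xh z) (Xg z) = 0)) ↔
      ∀ x s, T x s s s = 0 := by
    constructor
    · rintro ⟨-, h⟩ x s
      obtain ⟨p, rfl⟩ := sharp_surj hg hgs x s
      have := Tval x p
      rw [h] at this
      linarith
    · intro h
      have h' : ∀ z, symp z (Xh z) (Xg z) = 0 := by
        rintro ⟨x, p⟩
        rw [Tval, h, mul_zero]
      exact ⟨fun z => by rw [brk, h'], h'⟩
  have Tsym : ∀ x u v w, T x u v w = T x u w v := by
    intro x u v w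
    simp only [hT, ga1, gs1, Psym]
    have h := Asym x u v w
    have e1 := hg.symm x (prH x v) (Γg x u w)
    have e2 := hg.symm x v (Γg x u (prH x w))
    have e3 := hg.symm x v (fderiv ℝ prH x u w)
    linarith
  have hPQ0 : ∀ x v, prH x (prV x v) = 0 := by
    intro x v; rw [hQv, map_sub, hpr.idem, sub_self]
  have hQP0 : ∀ x v, prV x (prH x v) = 0 := by
    intro x v; rw [hQv, hpr.idem, sub_self]
  have hQQ : ∀ x v, prV x (prV x v) = prV x v := by
    intro x v; rw [hQv x (prV x v), hPQ0, sub_zero]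
  have Tpp : ∀ x u v w, T x u (prH x v) (prH x w) = 0 := by
    intro x u v w
    simp only [hT]
    rw [← Psym]
    simp [hpr.idem, APz]
    rw [hg.symm, g0]
  have Tqq : ∀ x u v w, T x u (prV x v) (prV x w) = 0 := by
    intro x u v w
    simp only [hT]
    rw [← Qsym, hPQ0]
    have h := Aid x u (prV x v)
    rw [hPQ0] at h
    simp only [map_zero, zero_add] at h
    rw [map_zero, add_zero, map_sub, hQP0, ← h, hQP0, sub_zero, hg.symm, g0]
  have step2 : ∀ x, (∀ s, T x s s s = 0) ↔ ∀ u v w, T x (prH x v) u (prH x w)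
      + T x (prH x w) u (prH x v) - T x (prV x v) u (prV x w) - T x (prV x w) u (prV x v) = 0 := by
    intro x
    refine cubic_iff (T x) (prH x) (prV x) (hpr.compl x) (map_add _) (map_add _) (map_neg _)
      (map_neg _) (hpr.idem x) (hQQ x) (hPQ0 x) (hQP0 x) ?_ ?_ ?_ ?_ ?_ ?_ (Tsym x) (Tpp x) (Tqq x)
    · intro u u' v w
      simp only [hT, ← ga1]; congr 1; simp; abel
    · intro u u' v w
      simp only [hT, ← ga1]; congr 1; simp; abel
    · intro u u' v w
      simp only [hT, ← ga2]
    · intro u v w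
      simp only [hT, ← gn1]; congr 1; simp; abel
    · intro u v w
      simp only [hT, ← gn1]; congr 1; simp; abel
    · intro u v w
      simp only [hT, ← gn2]
  have hat : ∀ x u v, hatN Γg prH prV (fun _ => u) (fun _ => v) x = Γg x u v
      + prH x (fderiv ℝ prH x u v + Γg x u (prH x v) - prH x (Γg x u v))
      - prV x (fderiv ℝ prH x u v + Γg x u (prH x v) - prH x (Γg x u v))
      + prH x (fderiv ℝ prH x (prH x v) u + Γg x (prH x v) (prH x u) - prH x (Γg x (prH x v) u))
      - prV x (fderiv ℝ prH x (prV x v) u + Γg x (prV x v) (prH x u)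
          - prH x (Γg x (prV x v) u)) := by
    intro x u v
    simp only [hatN, cov, lieB, (hPc x _).fderiv, (hQc x _).fderiv]
    have t1 := hLC.1 x (prH x v) u
    have t2 := hLC.1 x (prH x v) (prH x u)
    have t3 := hLC.1 x v (prH x u)
    have t4 := hLC.1 x v u
    simp only [hQv, map_sub, map_add, hpr.idem, neg_apply,
      sub_apply, ContinuousLinearMap.flip_apply, t1, t2, t3, t4, map_neg]
    abel
  have cm : ∀ x u v w, covMetPt (hatN Γg prH prV) g x u v w
      = -(T x (prH x v) u (prH x w)
      + T x (prH x w) u (prH x v) - T x (prV x v) u (prV x w) - T x (prV x w) u (prV x v)) := by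
    intro x u v w
    simp only [covMetPt, covMet, hat]
    rw [hLC.2 x u v w]
    have hs : ∀ a b c, T x a b c = g x (fderiv ℝ prH x a b + Γg x a (prH x b)
      - prH x (Γg x a b)) c := fun _ _ _ => rfl
    have l : ∀ v w, g x (Γg x u v
      + prH x (fderiv ℝ prH x u v + Γg x u (prH x v) - prH x (Γg x u v))
      - prV x (fderiv ℝ prH x u v + Γg x u (prH x v) - prH x (Γg x u v))
      + prH x (fderiv ℝ prH x (prH x v) u + Γg x (prH x v) (prH x u) - prH x (Γg x (prH x v) u))
      - prV x (fderiv ℝ prH x (prV x v) u + Γg x (prV x v) (prH x u)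
          - prH x (Γg x (prV x v) u))) w = g x (Γg x u v) w + T x u v (prH x w)
          - T x u v (prV x w) + T x (prH x v) u (prH x w) - T x (prV x v) u (prV x w) := by
      intro v w
      rw [gs1, ga1, gs1, ga1]
      simp only [Psym, Qsym, ← hs]
    rw [l, hg.symm x v (Γg x u w), hg.symm x v, l]
    have Ta2 : ∀ u v v' w, T x u (v + v') w = T x u v w + T x u v' w := by
      intro u u' v w
      simp only [hT, ← ga1]; congr 1; simp; abel
    have q1 : ∀ v w, T x u v (prH x w) = T x u (prV x v) (prH x w) := by
      intro v w
      conv_lhs => rw [← hpr.compl x v]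
      rw [Ta2, Tpp, zero_add]
    have q2 : ∀ v w, T x u v (prV x w) = T x u (prV x w) (prH x v) := by
      intro v w
      conv_lhs => rw [← hpr.compl x v]
      rw [Ta2, Tqq, add_zero, Tsym]
    rw [q1 v w, q1 w v, q2 v w, q2 w v]
    ring
  rw [step1]
  constructor
  · intro h x u v w
    rw [cm, (step2 x).1 (h x) u v w, neg_zero]
  · intro h x
    refine (step2 x).2 fun u v w => ?_
    have := h x u v w
    rw [cm] at this
    linarith
end
end

section
/- Let (M, g) be a Riemannian manifold, H a subbundle of TM with g-orthogonal complement V, and ∇̂ the associated connection. Then for any v, w ∈ T_xM, x ∈ M, one has (∇̂_v g)(w, w) = (∇̂_{pr_H v} g)(pr_V w, pr_V w) + (∇̂_{pr_V v} g)(pr_H w, pr_H w). -/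
/-!
We work with manifolds modelled as (finite-dimensional real) normed vector spaces,
so that the tangent space at every point of `E` is `E` itself, the cotangent space is
`Dual E = E →L[ℝ] ℝ`, the cotangent bundle is `E × Dual E`, vector fields are maps
`E → E`, one-forms are maps `E → Dual E`, and affine connections are encoded by their
Christoffel tensors `Γ : E → E →L[ℝ] E →L[ℝ] E` via `∇_X Y = (DY)(X) + Γ(X, Y)`.
-/

noncomputable section

namespace SubRiemannian

theorem aux_metric_fderiv {E : Type*} [NormedAddCommGroup E] [NormedSpace ℝ E]
    [FiniteDimensional ℝ E] (g : E → E → E → ℝ) (hg : IsMetric g)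
    (Y Z : E → E) (Y' Z' : E →L[ℝ] E) (x u : E)
    (hY : HasFDerivAt Y Y' x) (hZ : HasFDerivAt Z Z' x) :
    fderiv ℝ (fun y => g y (Y y) (Z y)) x u
      = fderiv ℝ (fun y => g y (Y x) (Z x)) x u + g x (Y' u) (Z x) + g x (Y x) (Z' u) := by
  have hd : DifferentiableAt ℝ (fun q : E × E × E => g q.1 q.2.1 q.2.2) (x, Y x, Z x) :=
    (hg.smooth.differentiable (by simp)) _
  have hG := hd.hasFDerivAt
  set G' := fderiv ℝ (fun q : E × E × E => g q.1 q.2.1 q.2.2) (x, Y x, Z x) with hG'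
  have h1 := HasFDerivAt.comp (f := fun y => (y, Y y, Z y)) x hG
    ((hasFDerivAt_id x).prodMk (hY.prodMk hZ))
  have h2 := HasFDerivAt.comp (f := fun y => (y, Y x, Z x)) x hG
    ((hasFDerivAt_id x).prodMk ((hasFDerivAt_const (Y x) x).prodMk (hasFDerivAt_const (Z x) x)))
  have h3 := HasFDerivAt.comp (f := fun y => (x, y, Z x)) (Y x) hG
    ((hasFDerivAt_const x (Y x)).prodMk
      ((hasFDerivAt_id (Y x)).prodMk (hasFDerivAt_const (Z x) (Y x))))
  have h4 := HasFDerivAt.comp (f := fun y => (x, Y x, y)) (Z x) hG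
    ((hasFDerivAt_const x (Z x)).prodMk
      ((hasFDerivAt_const (Y x) (Z x)).prodMk (hasFDerivAt_id (Z x))))
  have h3' := (LinearMap.toContinuousLinearMap ((hg.linL x (Z x)).mk')).hasFDerivAt (x := Y x)
  have h4' := (LinearMap.toContinuousLinearMap ((hg.linR x (Y x)).mk')).hasFDerivAt (x := Z x)
  have e1 : fderiv ℝ (fun y => g y (Y y) (Z y)) x u = G' (u, Y' u, Z' u) := by
    have := congrArg (fun L => L u) h1.fderiv
    simpa [Function.comp_def] using this
  have e2 : fderiv ℝ (fun y => g y (Y x) (Z x)) x u = G' (u, 0, 0) := by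
    have := congrArg (fun L => L u) h2.fderiv
    simpa [Function.comp_def] using this
  have e3 : g x (Y' u) (Z x) = G' (0, Y' u, 0) := by
    have := congrArg (fun L => L (Y' u)) (h3'.unique h3)
    simpa using this
  have e4 : g x (Y x) (Z' u) = G' (0, 0, Z' u) := by
    have := congrArg (fun L => L (Z' u)) (h4'.unique h4)
    simpa using this
  rw [e1, e2, e3, e4, ← map_add, ← map_add]
  simp

theorem aux_key {E : Type*} [NormedAddCommGroup E] [NormedSpace ℝ E] [FiniteDimensional ℝ E]
    (g : E → E → E → ℝ) (hg : IsMetric g)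
    (prH prV : E → E →L[ℝ] E) (hpr : IsOrthProjs g prH prV)
    (Γ : E → E →L[ℝ] E →L[ℝ] E) (hLC : IsLeviCivita g Γ) (x u c : E) :
    covMetPt (hatN Γ prH prV) g x u c c
      = 2 * (g x (Γ x (prH x u) (prV x c)) (prV x c)
        + g x (fderiv ℝ prH x (prV x c) (prH x u)) (prV x c)
        + g x (Γ x (prV x u) (prH x c)) (prH x c)
        - g x (fderiv ℝ prH x (prH x c) (prV x u)) (prH x c)) := by
  have hP : HasFDerivAt prH (fderiv ℝ prH x) x :=
    ((hpr.smooth.differentiable (by simp)) x).hasFDerivAt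
  have hVeq : prV = fun y => ContinuousLinearMap.id ℝ E - prH y := by
    funext y; ext z
    have := hpr.compl y z
    simp only [ContinuousLinearMap.sub_apply, ContinuousLinearMap.id_apply]
    exact eq_sub_of_add_eq' this
  have hV : HasFDerivAt prV (-fderiv ℝ prH x) x := by
    rw [hVeq]
    exact hP.const_sub (ContinuousLinearMap.id ℝ E)
  set A := fderiv ℝ prH x with hA
  have dP (d : E) : HasFDerivAt (fun y => prH y d) (A.flip d) x := by
    convert hP.clm_apply (hasFDerivAt_const d x) using 1
    ext; simp
  have dV (d : E) : HasFDerivAt (fun y => prV y d) (-(A.flip d)) x := by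
    convert hV.clm_apply (hasFDerivAt_const d x) using 1
    ext; simp
  have gaL (a b d : E) : g x (a + b) d = g x a d + g x b d := (hg.linL x d).map_add a b
  have gaR (a b d : E) : g x d (a + b) = g x d a + g x d b := (hg.linR x d).map_add a b
  have gnL (a d : E) : g x (-a) d = - g x a d := (hg.linL x d).map_neg a
  have gnR (a d : E) : g x d (-a) = - g x d a := (hg.linR x d).map_neg a
  have hor (a b : E) : g x (prH x a) (prV x b) = 0 := hpr.orth x a b
  have hor' (a b : E) : g x (prV x b) (prH x a) = 0 := by rw [hg.symm]; exact hor a b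
  have sP (a b : E) : g x (prH x a) b = g x a (prH x b) := by
    conv_lhs => rw [← hpr.compl x b]
    conv_rhs => rw [← hpr.compl x a]
    rw [gaL, gaR, hor, hor']
  have sV (a b : E) : g x (prV x a) b = g x a (prV x b) := by
    conv_lhs => rw [← hpr.compl x b]
    conv_rhs => rw [← hpr.compl x a]
    rw [gaL, gaR, hor, hor']
  have hid (t d : E) : A t d = A t (prH x d) + prH x (A t d) := by
    have h1 := hP.clm_apply (dP d)
    have h2 : (fun y => prH y (prH y d)) = fun y => prH y d := by
      funext y; exact hpr.idem y d
    rw [h2] at h1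
    have := congrArg (fun L => L t) ((dP d).unique h1)
    simpa [add_comm] using this
  have hPP (d : E) : prH x (prH x d) = prH x d := hpr.idem x d
  have hPV (d : E) : prH x (prV x d) = 0 := by
    have := hPP d
    have h := congrArg (prH x) (hpr.compl x d)
    rw [map_add, this] at h
    simpa using h
  have hVP (d : E) : prV x (prH x d) = 0 := by
    have := hpr.compl x (prH x d)
    rw [hPP] at this
    simpa using this
  have g0L (d : E) : g x 0 d = 0 := (hg.linL x d).map_zero
  have g0R (d : E) : g x d 0 = 0 := (hg.linR x d).map_zero
  have k1 (t d e : E) : g x (A t (prH x d)) (prH x e) = 0 := by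
    have := hid t (prH x d)
    rw [hPP] at this
    have h0 : prH x (A t (prH x d)) = 0 := by simpa using this
    rw [← sP, h0, g0L]
  have k2 (t d e : E) : g x (A t (prV x d)) (prV x e) = 0 := by
    have := hid t (prV x d)
    rw [hPV, map_zero, zero_add] at this
    rw [this, hor]
  have hsplit (t d : E) : A t d = A t (prH x d) + A t (prV x d) := by
    rw [← map_add, hpr.compl]
  have ho : g x (Γ x u (prH x c)) (prV x c) + g x (prH x c) (Γ x u (prV x c))
      + g x (A u c) (prV x c) - g x (prH x c) (A u c) = 0 := by
    have h := aux_metric_fderiv g hg (fun y => prH y c) (fun y => prV y c) _ _ x u (dP c) (dV c)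
    have h0 : (fun y => g y (prH y c) (prV y c)) = fun _ => 0 := by
      funext y; exact hpr.orth y c c
    rw [h0, hLC.2] at h
    simp [gnR] at h
    linarith
  have fP (d t : E) : fderiv ℝ (fun y => prH y d) x t = A t d := by rw [(dP d).fderiv]; simp
  have fV (d t : E) : fderiv ℝ (fun y => prV y d) x t = -A t d := by rw [(dV d).fderiv]; simp
  have hsw : g x c (hatN Γ prH prV (fun _ => u) (fun _ => c) x)
      = g x (hatN Γ prH prV (fun _ => u) (fun _ => c) x) c := hg.symm _ _ _
  have hsw2 : g x c (Γ x u c) = g x (Γ x u c) c := hg.symm _ _ _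
  have hhat : g x (hatN Γ prH prV (fun _ => u) (fun _ => c) x) c
      = g x (A u c) (prH x c) + g x (Γ x (prH x u) (prH x c)) (prH x c)
        + g x (A (prH x c) u) (prH x c)
        - g x (A u c) (prV x c) + g x (Γ x (prV x u) (prV x c)) (prV x c)
        - g x (A (prV x c) u) (prV x c) := by
    have hu : A u c = A (prH x u) c + A (prV x u) c := by
      rw [← ContinuousLinearMap.add_apply, ← map_add, hpr.compl]
    simp only [hatN, cov, lieB, fP, fV, gaL, sP, sV, gnL, sub_eq_add_neg, hu]
    ring
  have hΓ : g x (Γ x u c) c = g x (Γ x u (prH x c)) (prV x c) + g x (Γ x u (prV x c)) (prH x c)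
      + g x (Γ x (prH x u) (prH x c)) (prH x c) + g x (Γ x (prV x u) (prH x c)) (prH x c)
      + g x (Γ x (prH x u) (prV x c)) (prV x c) + g x (Γ x (prV x u) (prV x c)) (prV x c) := by
    have e (d f : E) : g x (Γ x u d) f = g x (Γ x (prH x u) d) f + g x (Γ x (prV x u) d) f := by
      rw [← gaL, ← ContinuousLinearMap.add_apply, ← map_add, hpr.compl]
    have e1 : g x (Γ x u c) c = g x (Γ x u (prH x c)) (prH x c) + g x (Γ x u (prH x c)) (prV x c)
        + g x (Γ x u (prV x c)) (prH x c) + g x (Γ x u (prV x c)) (prV x c) := by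
      rw [← gaR, hpr.compl, add_assoc, ← gaR, hpr.compl, ← gaL, ← map_add, hpr.compl]
    rw [e1, e _ (prH x c), e (prV x c) (prV x c), e (prV x c) (prH x c)]
    ring
  have m1 : g x (A (prH x c) u) (prH x c) = g x (A (prH x c) (prV x u)) (prH x c) := by
    rw [hsplit _ u, gaL, k1, zero_add]
  have m2 : g x (A (prV x c) u) (prV x c) = g x (A (prV x c) (prH x u)) (prV x c) := by
    rw [hsplit _ u, gaL, k2, add_zero]
  have e1 := hg.symm x (prH x c) (Γ x u (prV x c))
  have e2 := hg.symm x (prH x c) (A u c)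
  have hmain : covMetPt (hatN Γ prH prV) g x u c c
      = 2 * g x (Γ x u c) c - 2 * g x (hatN Γ prH prV (fun _ => u) (fun _ => c) x) c := by
    simp only [covMetPt, covMet]
    rw [hLC.2, hsw, hsw2]; ring
  rw [hmain, hhat, hΓ, m1, m2]
  linarith

end SubRiemannian

open SubRiemannian in
/-- **Splitting of the covariant derivative of the metric for `∇̂`.**
Let `(M, g)` be a Riemannian manifold, `H` a subbundle of `TM` with `g`-orthogonal
complement `V`, and `∇̂` the associated connection.  Then for any `v, w ∈ T_x M`:
`(∇̂_v g)(w, w) = (∇̂_{pr_H v} g)(pr_V w, pr_V w) + (∇̂_{pr_V v} g)(pr_H w, pr_H w)`. -/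
theorem statement7
    {E : Type*} [NormedAddCommGroup E] [NormedSpace ℝ E] [FiniteDimensional ℝ E]
    (g : E → E → E → ℝ) (hg : IsMetric g)
    (prH prV : E → E →L[ℝ] E) (hpr : IsOrthProjs g prH prV)
    (Γg : E → E →L[ℝ] E →L[ℝ] E) (hΓs : ContDiff ℝ (⊤ : ℕ∞) Γg) (hLC : IsLeviCivita g Γg)
    (x : E) (v w : E) :
    covMetPt (hatN Γg prH prV) g x v w w
      = covMetPt (hatN Γg prH prV) g x (prH x v) (prV x w) (prV x w)
        + covMetPt (hatN Γg prH prV) g x (prV x v) (prH x w) (prH x w) := by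
  have hPP (d : E) : prH x (prH x d) = prH x d := hpr.idem x d
  have hPV (d : E) : prH x (prV x d) = 0 := by
    have h := congrArg (prH x) (hpr.compl x d)
    rw [map_add, hPP d] at h
    simpa using h
  have hVP (d : E) : prV x (prH x d) = 0 := by
    have := hpr.compl x (prH x d)
    rw [hPP] at this
    simpa using this
  have hVV (d : E) : prV x (prV x d) = prV x d := by
    have := hpr.compl x (prV x d)
    rwa [hPV, zero_add] at this
  have g0 (d : E) : g x d 0 = 0 := (hg.linR x d).map_zero
  rw [aux_key g hg prH prV hpr Γg hLC, aux_key g hg prH prV hpr Γg hLC,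
    aux_key g hg prH prV hpr Γg hLC]
  simp only [hPP, hPV, hVP, hVV, g0]
  ring
end
end

section
/- Let (M, H, h) be a sub-Riemannian manifold, g a Riemannian metric taming h, V the g-orthogonal complement of H, and ∇̂ the associated connection. Then for every covector α ∈ T*M, (∇̂_{♯_h α} v*)(α, α) = −(∇̂_{pr_H ♯α} g)(pr_V ♯α, pr_V ♯α) and (∇̂_{♯_v α} h*)(α, α) = −(∇̂_{pr_V ♯α} g)(pr_H ♯α, pr_H ♯α), where ♯ is the identification of T*M with TM via g; in particular ♯_h α = pr_H ♯α and ♯_v α = pr_V ♯α. -/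
/-!
We work with manifolds modelled as (finite-dimensional real) normed vector spaces,
so that the tangent space at every point of `E` is `E` itself, the cotangent space is
`Dual E = E →L[ℝ] ℝ`, the cotangent bundle is `E × Dual E`, vector fields are maps
`E → E`, one-forms are maps `E → Dual E`, and affine connections are encoded by their
Christoffel tensors `Γ : E → E →L[ℝ] E →L[ℝ] E` via `∇_X Y = (DY)(X) + Γ(X, Y)`.
-/

noncomputable section

namespace SubRiemannian

lemma hatN_swap {E : Type*} [NormedAddCommGroup E] [NormedSpace ℝ E]
    (Γ : E → E →L[ℝ] E →L[ℝ] E) (prH prV : E → E →L[ℝ] E) :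
    hatN Γ prH prV = hatN Γ prV prH := by
  funext X Y x
  simp only [hatN]
  abel

lemma orthProjs_swap {E : Type*} [NormedAddCommGroup E] [NormedSpace ℝ E]
    {g : E → E → E → ℝ} (hg : IsMetric g) {prH prV : E → E →L[ℝ] E}
    (hpr : IsOrthProjs g prH prV) : IsOrthProjs g prV prH := by
  have hV : ∀ x v, prV x v = v - prH x v := fun x v => by
    rw [eq_sub_iff_add_eq, add_comm]; exact hpr.compl x v
  have hV' : prV = fun x => ContinuousLinearMap.id ℝ E - prH x := by
    funext x; ext v; simp [hV]
  refine ⟨?_, ?_, ?_, ?_⟩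
  · rw [hV']; exact contDiff_const.sub hpr.smooth
  · intro x v; rw [add_comm]; exact hpr.compl x v
  · intro x v; simp only [hV, map_sub, hpr.idem]; simp
  · intro x u v; rw [hg.symm]; exact hpr.orth x v u

/-- The first identity. -/
lemma key {E : Type*} [NormedAddCommGroup E] [NormedSpace ℝ E] [FiniteDimensional ℝ E]
    (g : E → E → E → ℝ) (hg : IsMetric g)
    (gsharp : E → Dual E → E) (hgs : IsSharp g gsharp)
    (prH prV : E → E →L[ℝ] E) (hpr : IsOrthProjs g prH prV)
    (Γg : E → E →L[ℝ] E →L[ℝ] E)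
    (x : E) (α : Dual E) :
    covCoHat Γg prH prV (subStar prV gsharp) (subSharp prV gsharp)
        x (subSharp prH gsharp x α) α
      = -covMetPt (hatN Γg prH prV) g x (prH x (gsharp x α))
          (prV x (gsharp x α)) (prV x (gsharp x α)) := by
  have hpr' := orthProjs_swap hg hpr
  have hHV : ∀ y v, prH y (prV y v) = 0 := fun y v => by
    have h := hpr.compl y (prV y v)
    rw [hpr'.idem] at h
    simpa using h
  have hVH : ∀ y v, prV y (prH y v) = 0 := fun y v => by
    have h := hpr.compl y (prH y v)
    rw [hpr.idem] at h
    simpa using h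
  have addL : ∀ y u u' v, g y (u + u') v = g y u v + g y u' v :=
    fun y u u' v => (hg.linL y v).map_add u u'
  have addR : ∀ y u v v', g y u (v + v') = g y u v + g y u v' :=
    fun y u v v' => (hg.linR y u).map_add v v'
  have dH : Differentiable ℝ prH := hpr.smooth.differentiable (by simp)
  have dV : Differentiable ℝ prV := hpr'.smooth.differentiable (by simp)
  have dS : Differentiable ℝ (fun y => gsharp y α) := by
    have h1 := hgs.smooth.differentiable (by simp)
    exact h1.comp (differentiable_id.prodMk (differentiable_const α))
  have dG : Differentiable ℝ (fun q : E × E × E => g q.1 q.2.1 q.2.2) :=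
    hg.smooth.differentiable (by simp)
  obtain ⟨B, hB⟩ : ∃ B : E → E, B = fun y => prV y (gsharp y α) := ⟨_, rfl⟩
  have dB : Differentiable ℝ B := by
    rw [hB]; exact fun y => (dV y).clm_apply (dS y)
  obtain ⟨a, ha⟩ : ∃ a, a = prH x (gsharp x α) := ⟨_, rfl⟩
  obtain ⟨b, hb⟩ : ∃ b, b = prV x (gsharp x α) := ⟨_, rfl⟩
  have hBx : B x = b := by rw [hB, hb]
  have hHB : ∀ y, prH y (B y) = 0 := fun y => by rw [hB]; exact hHV y _
  have hVa : prV x a = 0 := by rw [ha]; exact hVH x _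
  have hHa : prH x a = a := by rw [ha]; exact hpr.idem x _
  have hHb : prH x b = 0 := by rw [hb]; exact hHV x _
  have hVb : prV x b = b := by rw [hb]; exact hpr'.idem x _
  have hα : ∀ w, α w = g x a w + g x b w := fun w => by
    rw [← addL, ha, hb, hpr.compl, hgs.spec]
  have hαB : ∀ y, α (B y) = g y (B y) (B y) := fun y => by
    rw [← hgs.spec y α (B y)]
    conv_lhs => rw [← hpr.compl y (gsharp y α), addL]
    rw [hB]
    simp only [hpr.orth, zero_add]
  obtain ⟨c, hc⟩ : ∃ c, c = fderiv ℝ B x a := ⟨_, rfl⟩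
  have e1 : fderiv ℝ (fun y => α (B y)) x a = α c := by
    have := (α.hasFDerivAt.comp x (dB x).hasFDerivAt).fderiv
    simp only [Function.comp_def] at this
    rw [this, hc]; rfl
  have e2 : fderiv ℝ (fun y => g y (B y) (B y)) x a
      = fderiv ℝ (fun y => g y b b) x a + 2 * g x c b := by
    set G' := fderiv ℝ (fun q : E × E × E => g q.1 q.2.1 q.2.2) (x, b, b) with hG'
    have hG : HasFDerivAt (fun q : E × E × E => g q.1 q.2.1 q.2.2) G' (x, b, b) :=
      (dG _).hasFDerivAt
    have t1 : fderiv ℝ (fun y => g y (B y) (B y)) x a = G' (a, c, c) := by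
      have h1 : HasFDerivAt (fun y => (y, B y, B y))
          ((ContinuousLinearMap.id ℝ E).prod ((fderiv ℝ B x).prod (fderiv ℝ B x))) x :=
        (hasFDerivAt_id x).prodMk ((dB x).hasFDerivAt.prodMk (dB x).hasFDerivAt)
      have h2 := (HasFDerivAt.comp x (by rw [hBx]; exact hG) h1).fderiv
      simp only [Function.comp_def] at h2
      rw [h2, hc]; rfl
    have t2 : fderiv ℝ (fun y => g y b b) x a = G' (a, 0, 0) := by
      have h1 : HasFDerivAt (fun y : E => (y, b, b))
          ((ContinuousLinearMap.id ℝ E).prod ((0 : E →L[ℝ] E).prod (0 : E →L[ℝ] E))) x :=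
        (hasFDerivAt_id x).prodMk ((hasFDerivAt_const b x).prodMk (hasFDerivAt_const b x))
      have h2 := (HasFDerivAt.comp x hG h1).fderiv
      simp only [Function.comp_def] at h2
      rw [h2]; rfl
    have t3 : g x c b = G' (0, c, 0) := by
      have h1 : HasFDerivAt (fun u : E => (x, u, b))
          ((0 : E →L[ℝ] E).prod ((ContinuousLinearMap.id ℝ E).prod (0 : E →L[ℝ] E))) b :=
        (hasFDerivAt_const x b).prodMk ((hasFDerivAt_id b).prodMk (hasFDerivAt_const b b))
      have h2 := HasFDerivAt.comp b hG h1
      have h3 := ((hg.linL x b).mk' _).toContinuousLinearMap.hasFDerivAt (x := b)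
      have h4 := congrArg (fun L => L c) (h3.unique h2)
      exact h4
    have t4 : g x b c = G' (0, 0, c) := by
      have h1 : HasFDerivAt (fun u : E => (x, b, u))
          ((0 : E →L[ℝ] E).prod ((0 : E →L[ℝ] E).prod (ContinuousLinearMap.id ℝ E))) b :=
        (hasFDerivAt_const x b).prodMk ((hasFDerivAt_const b b).prodMk (hasFDerivAt_id b))
      have h2 := HasFDerivAt.comp b hG h1
      have h3 := ((hg.linR x b).mk' _).toContinuousLinearMap.hasFDerivAt (x := b)
      have h4 := congrArg (fun L => L c) (h3.unique h2)
      exact h4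
    have t5 : ((a, c, c) : E × E × E) = (a, 0, 0) + ((0, c, 0) + (0, 0, c)) := by simp
    rw [t1, t5, map_add, map_add, ← t2, ← t3, ← t4, hg.symm x b c]
    ring
  have e3 : fderiv ℝ (fun y => prH y b) x a + prH x c = 0 := by
    have h1 : HasFDerivAt (fun y => prH y (B y)) (0 : E →L[ℝ] E) x := by
      simp only [hHB]; exact hasFDerivAt_const 0 x
    have h2 := (dH x).hasFDerivAt.clm_apply (dB x).hasFDerivAt
    have h3 := congrArg (fun L => L a) (h2.unique h1)
    have h4 := ((dH x).hasFDerivAt.clm_apply (hasFDerivAt_const b x)).fderiv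
    rw [h4]
    simp [hBx] at h3 ⊢
    rw [hc, add_comm]; exact h3
  obtain ⟨N, hN⟩ : ∃ N, N = hatN Γg prH prV (fun _ => a) (fun _ => b) x := ⟨_, rfl⟩
  have e4 : prH x N = - prH x (prH x c) := by
    have h5 : fderiv ℝ (fun y => prH y b) x a = - prH x c := eq_neg_of_add_eq_zero_left e3
    rw [hN]
    simp only [hatN, cov, lieB, map_add, hHV, hpr.idem, hVa, hHa, hHb, h5, map_zero, map_neg,
      sub_self, add_zero]
  have e5 : ∀ w, g x a w = g x a (prH x w) := fun w => by
    conv_lhs => rw [← hpr.compl x w, addR]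
    rw [ha, hpr.orth, add_zero]
  have e6 : g x a N = - g x a c := by
    rw [e5 N, e5 c, e4, hpr.idem]
    exact (hg.linR x a).map_neg _
  have e7 : fderiv ℝ (fun y => g y b b) x a = α c - 2 * g x c b := by
    have : (fun y => g y (B y) (B y)) = fun y => α (B y) := by
      funext y; exact (hαB y).symm
    rw [this, e1] at e2
    linarith
  simp only [covCoHat, covMetPt, covMet, subStar, subSharp, hatGamma]
  have e8 : (fun y => α (prV y (gsharp y α))) = fun y => α (B y) := by rw [hB]
  rw [e8, ← ha, ← hb, ← hN, e1, e7, hα N, hα c, e6, hg.symm x N b, hg.symm x c b]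
  ring

end SubRiemannian

open SubRiemannian in
/-- **Covariant derivatives of the cometrics vs. covariant derivative of the metric.**
Let `(M, H, h)` be a sub-Riemannian manifold, `g` a Riemannian metric taming `h`, `V` the
`g`-orthogonal complement of `H`, and `∇̂` the associated connection.  Then for every
covector `α`:
`(∇̂_{♯_h α} v*)(α, α) = -(∇̂_{pr_H ♯α} g)(pr_V ♯α, pr_V ♯α)`,
`(∇̂_{♯_v α} h*)(α, α) = -(∇̂_{pr_V ♯α} g)(pr_H ♯α, pr_H ♯α)`,
and in particular `♯_h α = pr_H ♯α` and `♯_v α = pr_V ♯α`. -/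
theorem statement15
    {E : Type*} [NormedAddCommGroup E] [NormedSpace ℝ E] [FiniteDimensional ℝ E]
    (g : E → E → E → ℝ) (hg : IsMetric g)
    (gsharp : E → Dual E → E) (hgs : IsSharp g gsharp)
    (prH prV : E → E →L[ℝ] E) (hpr : IsOrthProjs g prH prV)
    (Γg : E → E →L[ℝ] E →L[ℝ] E) (hΓs : ContDiff ℝ (⊤ : ℕ∞) Γg) (hLC : IsLeviCivita g Γg)
    (x : E) (α : Dual E) :
    covCoHat Γg prH prV (subStar prV gsharp) (subSharp prV gsharp)
        x (subSharp prH gsharp x α) α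
      = -covMetPt (hatN Γg prH prV) g x (prH x (gsharp x α))
          (prV x (gsharp x α)) (prV x (gsharp x α))
    ∧ covCoHat Γg prH prV (subStar prH gsharp) (subSharp prH gsharp)
        x (subSharp prV gsharp x α) α
      = -covMetPt (hatN Γg prH prV) g x (prV x (gsharp x α))
          (prH x (gsharp x α)) (prH x (gsharp x α))
    ∧ subSharp prH gsharp x α = prH x (gsharp x α)
    ∧ subSharp prV gsharp x α = prV x (gsharp x α) := by
  refine ⟨key g hg gsharp hgs prH prV hpr Γg x α, ?_, rfl, rfl⟩
  have h := key g hg gsharp hgs prV prH (orthProjs_swap hg hpr) Γg x α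
  simp only [covCoHat, hatGamma] at h ⊢
  rw [hatN_swap Γg prH prV]
  exact h
end
end
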